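/- arXiv:math/0207105 — 2 statements merged into one kernel-verified Lean document; each statement's English description precedes it below -/
import Mathlib

section
/- Let W ⊆ V be a linear subspace of dimension v with 1 ≤ v ≤ m − 1. Then the design d = H_m \ W (of cardinality 2^m − 2^v) is a minimum aberration design. -/
open Finset Polynomial

/-- The ambient 𝔽₂-vector space `V = (ZMod 2)^m`. -/
abbrev V (m : ℕ) := Fin m → ZMod 2

/-- `Hm m` is the set of the `2^m - 1` nonzero vectors of `V m`. -/
def Hm (m : ℕ) : Finset (V m) := Finset.univ.filter (fun v => v ≠ 0)

/-- `Om m` is the set of odd-weight vectors of `V m`. -/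
def Om (m : ℕ) : Finset (V m) := Finset.univ.filter (fun v => (∑ i, v i) = 1)

/-- `Em m` is the set of nonzero even-weight vectors of `V m`. -/
def Em (m : ℕ) : Finset (V m) := Finset.univ.filter (fun v => v ≠ 0 ∧ (∑ i, v i) = 0)

/-- The number of `i`-element subsets of `d` whose elements sum to `ψ`. -/
def sumCount (m : ℕ) (d : Finset (V m)) (i : ℕ) (ψ : V m) : ℕ :=
  ((d.powersetCard i).filter (fun S => S.sum id = ψ)).card

/-- `wordCount m d i = a_i(d)`, the number of `i`-element subsets of `d` summing to `0`. -/
def wordCount (m : ℕ) (d : Finset (V m)) (i : ℕ) : ℕ := sumCount m d i 0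

/-- The rank of a finite set of vectors: the dimension of its span over `𝔽₂`. -/
noncomputable def rankOf (m : ℕ) (f : Finset (V m)) : ℕ :=
  Module.finrank (ZMod 2) (Submodule.span (ZMod 2) (f : Set (V m)))

/-- `d₁` has smaller aberration than `d₂`. -/
def SmallerAberration (m : ℕ) (d₁ d₂ : Finset (V m)) : Prop :=
  ∃ s, 1 ≤ s ∧ wordCount m d₁ s < wordCount m d₂ s ∧
    ∀ t < s, wordCount m d₁ t = wordCount m d₂ t

/-- `d` is a minimum aberration design. -/
def IsMA (m : ℕ) (d : Finset (V m)) : Prop :=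
  d ⊆ Hm m ∧ ∀ d' ⊆ Hm m, d'.card = d.card → ¬ SmallerAberration m d' d

/-- The word-length pattern polynomial `P_f(X) = ∑ a_i(f) X^i` of a design `f`. -/
noncomputable def WLPP (m : ℕ) (f : Finset (V m)) : Polynomial ℤ :=
  ∑ i ∈ Finset.range (f.card + 1), (wordCount m f i : ℤ) • X ^ i

/-- `Q_ψ(X) = ∑ q_i(ψ) X^i`, where `q_i(ψ)` counts `i`-element subsets of `O_m` summing to `ψ`. -/
noncomputable def Qpoly (m : ℕ) (ψ : V m) : Polynomial ℤ :=
  ∑ i ∈ Finset.range ((Om m).card + 1), (sumCount m (Om m) i ψ : ℤ) • X ^ i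

/-- The number of pairs `(x, y)` in `A × A` with `x + y ∈ A`. -/
def schurCount {G : Type*} [Add G] [DecidableEq G] (A : Finset G) : ℕ :=
  ((A ×ˢ A).filter (fun p => p.1 + p.2 ∈ A)).card

theorem schurCount_eq_sum {G : Type*} [Add G] [Fintype G] [DecidableEq G] (A : Finset G) :
    (schurCount A : ℤ) = ∑ x, ∑ y, (if x ∈ A then 1 else 0) * (if y ∈ A then 1 else 0) *
      (if x + y ∈ A then 1 else 0) := by
  rw [← Fintype.sum_prod_type', schurCount, Finset.card_filter, ← Finset.univ_product_univ]
  push_cast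
  refine Finset.sum_subset_zero_on_sdiff (fun p _ => by simp) ?_ ?_
  · rintro ⟨x, y⟩ h
    simp only [Finset.mem_sdiff, Finset.mem_product, not_and] at h
    by_cases hx : x ∈ A
    · simp [h.2 hx]
    · simp [hx]
  · rintro ⟨x, y⟩ h
    simp [(Finset.mem_product.1 h).1, (Finset.mem_product.1 h).2]

theorem schurCount_add_compl {G : Type*} [AddCommGroup G] [Fintype G] [DecidableEq G]
    (A : Finset G) :
    (schurCount A + schurCount Aᶜ : ℤ) =
      (Fintype.card G : ℤ) ^ 2 - 3 * Fintype.card G * A.card + 3 * (A.card : ℤ) ^ 2 := by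
  set a : G → ℤ := fun x => if x ∈ A then 1 else 0 with ha
  have hsum : ∑ x, a x = A.card := by simp [ha]
  have hshift (x : G) : ∑ y, a (x + y) = A.card := by
    rw [← hsum]; exact Equiv.sum_comp (Equiv.addLeft x) a
  have hcompl (x : G) : (if x ∈ Aᶜ then (1 : ℤ) else 0) = 1 - a x := by
    by_cases hx : x ∈ A <;> simp [ha, hx]
  have h3 : ∑ x, ∑ y, a y * a (x + y) = (A.card : ℤ) ^ 2 := by
    rw [Finset.sum_comm]
    simp_rw [← Finset.mul_sum, fun x y : G => add_comm x y, hshift]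
    rw [← Finset.sum_mul, hsum, sq]
  have h2 : ∑ x, ∑ y, a x * a (x + y) = (A.card : ℤ) ^ 2 := by
    simp_rw [← Finset.mul_sum, hshift]
    rw [← Finset.sum_mul, hsum, sq]
  have h1 : ∑ x, ∑ y, a x * a y = (A.card : ℤ) ^ 2 := by
    simp_rw [← Finset.mul_sum, hsum]
    rw [← Finset.sum_mul, hsum, sq]
  have e (x y : G) : (1 - a x) * (1 - a y) * (1 - a (x + y)) = 1 - a x - a y - a (x + y)
      + a x * a y + a x * a (x + y) + a y * a (x + y) - a x * a y * a (x + y) := by ring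
  rw [schurCount_eq_sum, schurCount_eq_sum]
  simp_rw [hcompl, e, Finset.sum_sub_distrib, Finset.sum_add_distrib, Finset.sum_sub_distrib,
    h1, h2, h3, hshift, hsum]
  simp only [Finset.sum_const, Finset.card_univ, nsmul_eq_mul, ← Finset.mul_sum, hsum]
  simp only [ha]
  ring

theorem schurCount_le {G : Type*} [Add G] [DecidableEq G] (A : Finset G) :
    schurCount A ≤ A.card * A.card :=
  (Finset.card_filter_le _ _).trans_eq (Finset.card_product _ _)

theorem schurCount_eq_iff {G : Type*} [Add G] [DecidableEq G] (A : Finset G) :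
    schurCount A = A.card * A.card ↔ ∀ x ∈ A, ∀ y ∈ A, x + y ∈ A := by
  rw [schurCount, ← Finset.card_product, Finset.card_filter_eq_iff]
  simp only [Finset.mem_product, Prod.forall]
  exact ⟨fun h x hx y hy => h x y ⟨hx, hy⟩, fun h x y hxy => h x hxy.1 y hxy.2⟩

theorem wordCount_one {m : ℕ} {d : Finset (V m)} (hd : d ⊆ Hm m) : wordCount m d 1 = 0 := by
  rw [wordCount, sumCount, Finset.card_eq_zero, Finset.filter_eq_empty_iff]
  intro S hS h0
  obtain ⟨hSd, hc⟩ := Finset.mem_powersetCard.1 hS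
  obtain ⟨x, rfl⟩ := Finset.card_eq_one.1 hc
  have := hd (hSd (Finset.mem_singleton_self x))
  simp_all [Hm]

theorem wordCount_two (m : ℕ) (d : Finset (V m)) : wordCount m d 2 = 0 := by
  rw [wordCount, sumCount, Finset.card_eq_zero, Finset.filter_eq_empty_iff]
  intro S hS h0
  obtain ⟨x, y, hxy, rfl⟩ := Finset.card_eq_two.1 (Finset.mem_powersetCard.1 hS).2
  rw [Finset.sum_pair hxy, id, id] at h0
  exact hxy (by rw [eq_neg_of_add_eq_zero_left h0, ZModModule.neg_eq_self])

theorem schurCount_eq_six_mul_wordCount {m : ℕ} {d : Finset (V m)} (hd : d ⊆ Hm m) :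
    schurCount d = 6 * wordCount m d 3 := by
  have hself (x : V m) : x + x = 0 := ZModModule.add_self x
  have hne {x : V m} (hx : x ∈ d) : x ≠ 0 := (Finset.mem_filter.1 (hd hx)).2
  rw [schurCount, wordCount, sumCount, Finset.card_eq_sum_card_fiberwise
    (f := fun p : V m × V m => ({p.1, p.2, p.1 + p.2} : Finset (V m)))
    (t := (d.powersetCard 3).filter (fun S => S.sum id = 0)), mul_comm]
  · refine Finset.sum_const_nat ?_
    intro S hS
    obtain ⟨hS, h0⟩ := Finset.mem_filter.1 hS
    obtain ⟨hSd, hc⟩ := Finset.mem_powersetCard.1 hS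
    have : S.offDiag.card = 6 := by rw [Finset.offDiag_card, hc]
    rw [← this]
    congr 1
    ext ⟨x, y⟩
    simp only [Finset.mem_filter, Finset.mem_product, Finset.mem_offDiag]
    constructor
    · rintro ⟨⟨⟨hx, hy⟩, hxy⟩, rfl⟩
      refine ⟨by simp, by simp, ?_⟩
      rintro rfl
      exact hne hxy (hself x)
    · rintro ⟨hx, hy, hxy⟩
      obtain ⟨z, hz⟩ : ∃ z, (S.erase x).erase y = {z} := by
        rw [← Finset.card_eq_one, Finset.card_erase_of_mem (by simp [hy, Ne.symm hxy]),
          Finset.card_erase_of_mem hx, hc]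
      have hS' : S = {x, y, z} := by
        rw [← hz, Finset.insert_erase (by simp [hy, Ne.symm hxy]), Finset.insert_erase hx]
      have hz' : z ∈ (S.erase x).erase y := by simp [hz]
      simp only [Finset.mem_erase] at hz'
      obtain ⟨hzy, hzx, hzS⟩ := hz'
      have hzz : x + y = z := by
        rw [hS', Finset.sum_insert (by simp [hxy, Ne.symm hzx]),
          Finset.sum_pair (Ne.symm hzy)] at h0
        simp only [id] at h0
        rw [← add_assoc] at h0
        rw [eq_neg_of_add_eq_zero_left h0, ZModModule.neg_eq_self]
      rw [hzz]
      exact ⟨⟨⟨hSd hx, hSd hy⟩, hSd hzS⟩, hS'.symm⟩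
  · rintro ⟨x, y⟩ hp
    simp only [Finset.coe_filter, Finset.mem_product, Set.mem_ofPred_eq] at hp
    obtain ⟨⟨hx, hy⟩, hxy⟩ := hp
    have h1 : x ≠ y := by
      rintro rfl
      exact hne hxy (hself x)
    have h2 : x ≠ x + y := by simpa using hne hy
    have h3 : y ≠ x + y := by simpa using hne hx
    simp only [Finset.coe_filter, Finset.mem_powersetCard, Set.mem_ofPred_eq]
    refine ⟨⟨?_, Finset.card_eq_three.2 ⟨x, y, x + y, h1, h2, h3, rfl⟩⟩, ?_⟩
    · intro z hz
      simp only [Finset.mem_insert, Finset.mem_singleton] at hz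
      rcases hz with rfl | rfl | rfl <;> assumption
    · rw [Finset.sum_insert (by simp [h1, hne hy]), Finset.sum_pair h3]
      simp only [id]
      rw [← add_assoc, hself]

theorem wordCount_map {m : ℕ} (e : V m ≃ₗ[ZMod 2] V m) (d : Finset (V m)) (i : ℕ) :
    wordCount m (d.map e.toEquiv.toEmbedding) i = wordCount m d i := by
  rw [wordCount, sumCount, Finset.powersetCard_map, Finset.filter_map, Finset.card_map,
    wordCount, sumCount]
  congr 1
  ext S
  simp only [Finset.mem_filter, Function.comp_apply, and_congr_right_iff]
  intro _
  rw [← e.map_eq_zero_iff (x := S.sum id), map_sum]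
  exact Eq.congr_left (Finset.sum_map S _ _)

theorem Submodule.exists_linearEquiv_mem_iff {K E : Type*} [DivisionRing K] [AddCommGroup E]
    [Module K E] [FiniteDimensional K E] (p q : Submodule K E)
    (h : Module.finrank K p = Module.finrank K q) :
    ∃ e : E ≃ₗ[K] E, ∀ x, e x ∈ q ↔ x ∈ p := by
  obtain ⟨p', hp⟩ := p.exists_isCompl
  obtain ⟨q', hq⟩ := q.exists_isCompl
  have h' : Module.finrank K p' = Module.finrank K q' := by
    have h1 := Submodule.finrank_add_eq_of_isCompl hp
    have h2 := Submodule.finrank_add_eq_of_isCompl hq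
    omega
  let e₁ := LinearEquiv.ofFinrankEq p q h
  let e₂ := LinearEquiv.ofFinrankEq p' q' h'
  refine ⟨(p.prodEquivOfIsCompl p' hp).symm ≪≫ₗ e₁.prodCongr e₂ ≪≫ₗ
    q.prodEquivOfIsCompl q' hq, fun x => ?_⟩
  obtain ⟨⟨a, b⟩, rfl⟩ := (p.prodEquivOfIsCompl p' hp).surjective x
  rw [← Submodule.prodEquivOfIsCompl_symm_apply_snd_eq_zero (h := hp),
    ← Submodule.prodEquivOfIsCompl_symm_apply_snd_eq_zero (h := hq)]
  simp

theorem finrank_eq_of_card_eq {m : ℕ} (p q : Submodule (ZMod 2) (V m))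
    (h : Nat.card p = Nat.card q) :
    Module.finrank (ZMod 2) p = Module.finrank (ZMod 2) q := by
  rw [Module.natCard_eq_pow_finrank (K := ZMod 2),
    Module.natCard_eq_pow_finrank (K := ZMod 2) (V := q)] at h
  exact Nat.pow_right_injective (by simp) h

/-- Removing from `H_m` a linear subspace of dimension `v`
(`1 ≤ v ≤ m - 1`) yields a minimum aberration design. -/
theorem complement_of_subspace_is_MA (m v : ℕ) (hm : 2 ≤ m)
    (hv1 : 1 ≤ v) (hv2 : v ≤ m - 1)
    (W : Submodule (ZMod 2) (V m)) (hW : Module.finrank (ZMod 2) W = v) :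
    IsMA m (@Finset.filter _ (fun x => x ∉ W) (Classical.decPred _) (Hm m)) := by
  classical
  set d := @Finset.filter _ (fun x => x ∉ W) (Classical.decPred _) (Hm m) with hd
  have hdH : d ⊆ Hm m :=
    @Finset.filter_subset _ _ (Classical.decPred _) _
  have hmem (x : V m) : x ∈ d ↔ x ∉ W := by
    simp only [hd, Hm, Finset.mem_filter, Finset.mem_univ, true_and, and_iff_right_iff_imp]
    rintro h rfl
    exact h W.zero_mem
  refine ⟨hdH, ?_⟩
  rintro d' hd' hcard ⟨s, hs1, hlt, heq⟩
  have hcardc : d'ᶜ.card = dᶜ.card := by rw [Finset.card_compl, Finset.card_compl, hcard]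
  have hclosed : schurCount dᶜ = dᶜ.card * dᶜ.card := by
    rw [schurCount_eq_iff]
    simp only [Finset.mem_compl, hmem, not_not]
    exact fun x hx y hy => W.add_mem hx hy
  have h1 := schurCount_add_compl d
  have h2 := schurCount_add_compl d'
  rw [hcard, ← h1, schurCount_eq_six_mul_wordCount hdH,
    schurCount_eq_six_mul_wordCount hd', hclosed] at h2
  have hle := schurCount_le d'ᶜ
  rw [hcardc] at hle
  rcases lt_trichotomy s 3 with hs | rfl | hs
  · interval_cases s
    · rw [wordCount_one hdH] at hlt; omega
    · rw [wordCount_two m d] at hlt; omega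
  · push_cast at h2
    zify at hle hlt
    linarith
  · have h3 := heq 3 hs
    have hcl : ∀ x ∈ d'ᶜ, ∀ y ∈ d'ᶜ, x + y ∈ d'ᶜ := by
      rw [← schurCount_eq_iff, hcardc]
      rw [h3] at h2
      exact_mod_cast add_left_cancel h2
    have h0 : (0 : V m) ∈ d'ᶜ := by
      rw [Finset.mem_compl]
      intro h
      simpa [Hm] using hd' h
    let W' : Submodule (ZMod 2) (V m) := AddSubgroup.toZModSubmodule 2
      { carrier := (d'ᶜ : Finset (V m))
        add_mem' := fun {a b} ha hb => hcl a ha b hb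
        zero_mem' := h0
        neg_mem' := fun {a} ha => by rwa [ZModModule.neg_eq_self] }
    have hmem' (x : V m) : x ∈ W' ↔ x ∉ d' := Finset.mem_compl
    obtain ⟨e, he⟩ := Submodule.exists_linearEquiv_mem_iff W W' (finrank_eq_of_card_eq W W' (by
      rw [Nat.card_congr (Equiv.subtypeEquivRight
          (q := fun x => x ∈ dᶜ) fun x => by simp [hmem]),
        Nat.card_congr (Equiv.subtypeEquivRight
          (q := fun x => x ∈ d'ᶜ) fun x => (hmem' x).trans Finset.mem_compl.symm)]
      simp only [Nat.card_eq_fintype_card, Fintype.card_coe, hcardc]))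
    have hmap : d.map e.toEquiv.toEmbedding = d' := by
      ext x
      obtain ⟨y, rfl⟩ := e.surjective x
      have := he y
      rw [hmem'] at this
      have hy : e.toEquiv.toEmbedding y ∈ d.map e.toEquiv.toEmbedding ↔ y ∈ d :=
        Finset.mem_map' _
      refine hy.trans ?_
      rw [hmem, ← this, not_not]
    rw [← hmap, wordCount_map] at hlt
    exact lt_irrefl _ hlt
end

section
/- For every r ≥ 1 and every ψ ∈ E_m, one has a_{2r}(O_m) + (2^{m−1} − 1)·#{S ⊆ O_m : |S| = 2r, ∑S = ψ} = C(2^{m−1}, 2r). In particular the number of 2r-element subsets of O_m summing to ψ is the same for every ψ ∈ E_m. -/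
open Finset Polynomial

/-- Two nonzero vectors admit a common functional taking the value `1` on both. -/
lemma exists_functional_eq_one {m : ℕ} {x y : V m} (hx : x ≠ 0) (hy : y ≠ 0) :
    ∃ f : V m →+ ZMod 2, f x = 1 ∧ f y = 1 := by
  have one_of_ne : ∀ a : ZMod 2, a ≠ 0 → a = 1 := by decide
  obtain ⟨i, hi⟩ := Function.ne_iff.1 hx
  obtain ⟨j, hj⟩ := Function.ne_iff.1 hy
  have hi := one_of_ne _ hi
  have hj := one_of_ne _ hj
  by_cases hyi : y i = 0
  · by_cases hxj : x j = 0
    · let f : V m →+ ZMod 2 :=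
        Pi.evalAddMonoidHom (fun _ => ZMod 2) i + Pi.evalAddMonoidHom (fun _ => ZMod 2) j
      have hf : ∀ v, f v = v i + v j := fun _ => rfl
      exact ⟨f, by rw [hf, hi, hxj, add_zero], by rw [hf, hj, hyi, zero_add]⟩
    · exact ⟨Pi.evalAddMonoidHom (fun _ => ZMod 2) j, one_of_ne _ hxj, hj⟩
  · exact ⟨Pi.evalAddMonoidHom (fun _ => ZMod 2) i, hi, one_of_ne _ hyi⟩

/-- A transvection preserving `Om m` carries any vector of `Em m` to any other one. -/
lemma exists_injective_map_Om {m : ℕ} {x y : V m} (hx : x ∈ Em m) (hy : y ∈ Em m) :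
    ∃ T : V m →+ V m, Function.Injective T ∧ (∀ v ∈ Om m, T v ∈ Om m) ∧ T x = y := by
  simp only [Em, mem_filter, mem_univ, true_and] at hx hy
  obtain ⟨f, hfx, hfy⟩ := exists_functional_eq_one hx.1 hy.1
  have hfw : f (x + y) = 0 := by rw [map_add, hfx, hfy]; decide
  let T : V m →+ V m :=
    { toFun := fun v => v + f v • (x + y)
      map_zero' := by simp
      map_add' := fun u v => by rw [map_add, add_smul]; abel }
  have hT : ∀ v, T v = v + f v • (x + y) := fun _ => rfl
  refine ⟨T, fun u v huv => ?_, fun v hv => ?_, ?_⟩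
  · have hf : ∀ v, f (T v) = f v := fun v => by
      have h : f (f v • (x + y)) = 0 := by
        rcases (by decide : ∀ a : ZMod 2, a = 0 ∨ a = 1) (f v) with h | h <;> simp [h, hfw]
      rw [hT, map_add, h, add_zero]
    have hfuv : f u = f v := by rw [← hf u, huv, hf]
    rw [hT, hT, hfuv] at huv
    exact add_right_cancel huv
  · simp only [Om, mem_filter, mem_univ, true_and] at hv ⊢
    simp [hT, sum_add_distrib, ← mul_sum, hv, hx.2, hy.2]
  · rw [hT, hfx, one_smul, ← add_assoc, ZModModule.add_self, zero_add]

lemma sumCount_le_of_injective {m : ℕ} {d : Finset (V m)} {T : V m →+ V m}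
    (hT : Function.Injective T) (hd : ∀ v ∈ d, T v ∈ d) (i : ℕ) (x : V m) :
    sumCount m d i x ≤ sumCount m d i (T x) := by
  refine card_le_card_of_injOn (fun S => S.image T) (fun S hS => ?_)
    (image_injective hT).injOn
  simp only [coe_filter, Set.mem_ofPred_eq, mem_powersetCard] at hS ⊢
  refine ⟨⟨image_subset_iff.2 fun v hv => hd v (hS.1.1 hv), ?_⟩, ?_⟩
  · rw [card_image_of_injective _ hT, hS.1.2]
  · rw [sum_image hT.injOn, ← hS.2, map_sum]
    rfl

lemma sumCount_Om_eq {m : ℕ} {x y : V m} (hx : x ∈ Em m) (hy : y ∈ Em m) (i : ℕ) :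
    sumCount m (Om m) i x = sumCount m (Om m) i y := by
  have le : ∀ {x y : V m}, x ∈ Em m → y ∈ Em m →
      sumCount m (Om m) i x ≤ sumCount m (Om m) i y := fun hx hy => by
    obtain ⟨T, hT, hd, rfl⟩ := exists_injective_map_Om hx hy
    exact sumCount_le_of_injective hT hd i _
  exact le_antisymm (le hx hy) (le hy hx)

lemma zero_notMem_Em (m : ℕ) : (0 : V m) ∉ Em m := by simp [Em]

lemma mem_insert_zero_Em {m : ℕ} {v : V m} : v ∈ insert 0 (Em m) ↔ ∑ i, v i = 0 := by
  by_cases h : v = 0 <;> simp [Em, h]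

lemma card_insert_zero_Em {m : ℕ} (hm : 1 ≤ m) : #(insert 0 (Em m)) = #(Om m) := by
  let e : V m := Pi.single ⟨0, hm⟩ 1
  have he : ∑ i, e i = 1 := by simp [e]
  refine card_nbij' (· + e) (· + e) ?_ ?_ ?_ ?_ <;> intro v hv
  · rw [mem_coe, mem_insert_zero_Em] at hv
    simp [Om, sum_add_distrib, hv, he]
  · simp only [Om, coe_filter, mem_univ, true_and, Set.mem_ofPred_eq] at hv
    rw [mem_coe, mem_insert_zero_Em]
    simp only [Pi.add_apply, sum_add_distrib, hv, he]
    decide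
  · simp [add_assoc, ZModModule.add_self]
  · simp [add_assoc, ZModModule.add_self]

lemma card_Om {m : ℕ} (hm : 1 ≤ m) : #(Om m) = 2 ^ (m - 1) := by
  have hcompl : (Om m)ᶜ = insert 0 (Em m) := by
    ext v
    rw [mem_insert_zero_Em]
    simpa [Om] using (by decide : ∀ a : ZMod 2, ¬a = 1 ↔ a = 0) _
  have hcard := card_add_card_compl (Om m)
  rw [hcompl, card_insert_zero_Em hm] at hcard
  obtain ⟨k, rfl⟩ := Nat.exists_eq_add_of_le' hm
  simp only [Fintype.card_pi, ZMod.card, prod_const, card_univ, Fintype.card_fin, pow_succ]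
    at hcard
  rw [Nat.add_sub_cancel]
  omega

lemma card_Em {m : ℕ} (hm : 1 ≤ m) : #(Em m) = 2 ^ (m - 1) - 1 := by
  rw [← card_Om hm, ← card_insert_zero_Em hm, card_insert_of_notMem (zero_notMem_Em m),
    Nat.add_sub_cancel]

lemma sum_mem_insert_zero_Em {m r : ℕ} {S : Finset (V m)}
    (hS : S ∈ (Om m).powersetCard (2 * r)) : S.sum id ∈ insert 0 (Em m) := by
  rw [mem_powersetCard] at hS
  rw [mem_insert_zero_Em]
  simp only [Finset.sum_apply, id]
  rw [sum_comm, sum_congr rfl fun v hv => (mem_filter.1 (hS.1 hv)).2]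
  simp [hS.2, CharTwo.two_eq_zero]

/-- For `r ≥ 1` and `ψ ∈ E_m`,
`a_{2r}(O_m) + (2^{m-1} - 1)·#{S ⊆ O_m : |S| = 2r, ∑S = ψ} = C(2^{m-1}, 2r)`;
in particular the count is the same for every `ψ ∈ E_m`. -/
theorem even_sum_count_constant_on_Em (m : ℕ) (hm : 2 ≤ m)
    (r : ℕ) (hr : 1 ≤ r) (ψ : V m) (hψ : ψ ∈ Em m) :
    wordCount m (Om m) (2 * r) + (2 ^ (m - 1) - 1) * sumCount m (Om m) (2 * r) ψ =
      Nat.choose (2 ^ (m - 1)) (2 * r) := by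
  have hm' : 1 ≤ m := by omega
  have hcount := card_eq_sum_card_fiberwise (s := (Om m).powersetCard (2 * r))
    fun S hS => sum_mem_insert_zero_Em hS
  rw [card_powersetCard, card_Om hm', sum_insert (zero_notMem_Em m)] at hcount
  rw [hcount, ← card_Em hm', ← sum_const_nat fun φ hφ => sumCount_Om_eq hφ hψ (2 * r)]
  rfl
end
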